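/- Let p be a positive integer, m₁, m₂ ∈ ℝ^p, and let Ω₁, Ω₂ be real symmetric positive definite p×p matrices. Then 2·KL(N(m₁, Ω₁⁻¹) ‖ N(m₂, Ω₂⁻¹)) ≤ (m₁ − m₂)ᵀ Ω₂ (m₁ − m₂) + tr(Ω₂ Ω₁⁻¹ − I) + tr(Ω₁ Ω₂⁻¹ − I), where I is the p×p identity matrix. -/

import Mathlib

open MeasureTheory ProbabilityTheory

/-- The positive semidefinite square root of a (real) positive semidefinite matrix
(Mathlib's former `Matrix.PosSemidef.sqrt`). -/
noncomputable def Matrix.PosSemidef.sqrt {n : Type*} [Fintype n] [DecidableEq n]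
    {A : Matrix n n ℝ} (hA : A.PosSemidef) : Matrix n n ℝ :=
  hA.1.eigenvectorUnitary.1 * Matrix.diagonal (fun i => Real.sqrt (hA.1.eigenvalues i)) *
    (star hA.1.eigenvectorUnitary : Matrix n n ℝ)

/-- The Gaussian measure `N(m, V)` on `ℝ^p` (for `V` positive semidefinite): the pushforward
of the `p`-fold product of standard normal distributions under `x ↦ m + V^{1/2} x`, where
`V^{1/2}` is the positive semidefinite square root of `V`. -/
noncomputable def gaussianEuclidean {p : ℕ} (m : EuclideanSpace ℝ (Fin p))
    {V : Matrix (Fin p) (Fin p) ℝ} (hV : V.PosSemidef) :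
    Measure (EuclideanSpace ℝ (Fin p)) :=
  (Measure.pi fun _ : Fin p => gaussianReal 0 1).map
    (fun x => m + (EuclideanSpace.equiv (Fin p) ℝ).symm (hV.sqrt.mulVec x))

/-- The Kullback–Leibler divergence `KL(μ‖ν) = ∫ log (dμ/dν) dμ`. -/
noncomputable def klDivergence {p : ℕ}
    (μ ν : Measure (EuclideanSpace ℝ (Fin p))) : ℝ :=
  ∫ x, Real.log (μ.rnDeriv ν x).toReal ∂μ

namespace Matrix

lemma PosSemidef.sqrt_mul_self {n : Type*} [Fintype n] [DecidableEq n]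
    {A : Matrix n n ℝ} (hA : A.PosSemidef) : hA.sqrt * hA.sqrt = A := by
  have hU : (star hA.1.eigenvectorUnitary : Matrix n n ℝ) * hA.1.eigenvectorUnitary.1 = 1 :=
    Unitary.coe_star_mul_self _
  have hD : diagonal (fun i => √(hA.1.eigenvalues i)) * diagonal (fun i => √(hA.1.eigenvalues i)) =
      diagonal hA.1.eigenvalues := by
    simp [diagonal_mul_diagonal, Real.mul_self_sqrt (hA.eigenvalues_nonneg _)]
  conv_rhs => rw [hA.1.spectral_theorem]
  rw [Unitary.conjStarAlgAut_apply]
  calc _ = hA.1.eigenvectorUnitary.1 * (diagonal (fun i => √(hA.1.eigenvalues i)) *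
        ((star hA.1.eigenvectorUnitary : Matrix n n ℝ) * hA.1.eigenvectorUnitary.1) *
        diagonal (fun i => √(hA.1.eigenvalues i))) *
        (star hA.1.eigenvectorUnitary : Matrix n n ℝ) := by
        simp only [PosSemidef.sqrt, Matrix.mul_assoc]
    _ = _ := by
        rw [hU, Matrix.mul_one, hD]
        rfl

lemma PosSemidef.transpose_sqrt {n : Type*} [Fintype n] [DecidableEq n]
    {A : Matrix n n ℝ} (hA : A.PosSemidef) : hA.sqrtᵀ = hA.sqrt := by
  simp [PosSemidef.sqrt, Matrix.mul_assoc, star_eq_conjTranspose,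
    conjTranspose_eq_transpose_of_trivial]

lemma PosSemidef.log_det_le {n : Type*} [Fintype n] [DecidableEq n]
    {A : Matrix n n ℝ} (hA : A.PosSemidef) (hdet : A.det ≠ 0) :
    Real.log A.det ≤ A.trace - Fintype.card n := by
  have hdet' : A.det = ∏ i, hA.1.eigenvalues i := by simpa using hA.1.det_eq_prod_eigenvalues
  have htr : A.trace = ∑ i, hA.1.eigenvalues i := by simpa using hA.1.trace_eq_sum_eigenvalues
  have hne : ∀ i ∈ Finset.univ, hA.1.eigenvalues i ≠ 0 :=
    Finset.prod_ne_zero_iff.mp (hdet' ▸ hdet)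
  rw [hdet', htr, Real.log_prod hne, ← Finset.card_univ, ← nsmul_one, ← Finset.sum_const,
    ← Finset.sum_sub_distrib]
  exact Finset.sum_le_sum fun i hi =>
    Real.log_le_sub_one_of_pos ((hA.eigenvalues_nonneg i).lt_of_ne (hne i hi).symm)

/-- The affine automorphism `x ↦ b + B x` as a measurable equivalence. -/
noncomputable def affineMeasurableEquiv {ι : Type*} [Fintype ι] [DecidableEq ι] (b : ι → ℝ)
    (B : Matrix ι ι ℝ) (hB : IsUnit B.det) : (ι → ℝ) ≃ᵐ (ι → ℝ) where
  toFun x := b + B *ᵥ x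
  invFun y := B⁻¹ *ᵥ (y - b)
  left_inv x := by simp [mulVec_mulVec, nonsing_inv_mul B hB]
  right_inv y := by simp [mulVec_mulVec, mul_nonsing_inv B hB]
  measurable_toFun := by
    have : Continuous fun x => b + B *ᵥ x := by fun_prop
    exact this.measurable
  measurable_invFun := by
    have : Continuous fun y => B⁻¹ *ᵥ (y - b) := by fun_prop
    exact this.measurable

@[simp]
lemma affineMeasurableEquiv_apply {ι : Type*} [Fintype ι] [DecidableEq ι] (b : ι → ℝ)
    (B : Matrix ι ι ℝ) (hB : IsUnit B.det) (x : ι → ℝ) :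
    affineMeasurableEquiv b B hB x = b + B *ᵥ x := rfl

lemma map_affineMeasurableEquiv_volume {ι : Type*} [Fintype ι] [DecidableEq ι] (b : ι → ℝ)
    (B : Matrix ι ι ℝ) (hB : IsUnit B.det) :
    (volume : Measure (ι → ℝ)).map (affineMeasurableEquiv b B hB) =
      ENNReal.ofReal |B.det⁻¹| • volume := by
  have hlin : Measurable (toLin' B) := (LinearMap.continuous_of_finiteDimensional _).measurable
  have hcomp : ⇑(affineMeasurableEquiv b B hB) = (fun x => b + x) ∘ toLin' B := by
    ext x; simp
  rw [hcomp, ← Measure.map_map (measurable_const_add b) hlin,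
    Real.map_matrix_volume_pi_eq_smul_volume_pi hB.ne_zero, Measure.map_smul,
    map_add_left_eq_self]

end Matrix

open Matrix

namespace MeasureTheory

lemma Measure.pi_withDensity_ofReal {ι : Type*} [Fintype ι] {E : ι → Type*}
    [∀ i, MeasurableSpace (E i)] (μ : ∀ i, Measure (E i)) [∀ i, SigmaFinite (μ i)]
    {f : ∀ i, E i → ℝ} (hf : ∀ i, Integrable (f i) (μ i)) (hf0 : ∀ i x, 0 ≤ f i x) :
    Measure.pi (fun i => (μ i).withDensity fun x => ENNReal.ofReal (f i x)) =
      (Measure.pi μ).withDensity fun x => ENNReal.ofReal (∏ i, f i (x i)) := by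
  have (i : ι) : IsFiniteMeasure ((μ i).withDensity fun x => ENNReal.ofReal (f i x)) :=
    isFiniteMeasure_withDensity_ofReal (hf i).2
  refine Measure.pi_eq fun s hs => ?_
  have hfs (i : ι) : Integrable (f i) ((μ i).restrict (s i)) := (hf i).restrict
  rw [withDensity_apply _ (MeasurableSet.univ_pi hs), Measure.restrict_pi_pi,
    ← ofReal_integral_eq_lintegral_ofReal (Integrable.fintype_prod_dep hfs)
      (ae_of_all _ fun x => Finset.prod_nonneg fun i _ => hf0 i (x i)),
    integral_fintype_prod_eq_prod,
    ENNReal.ofReal_prod_of_nonneg fun i _ => integral_nonneg (hf0 i)]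
  refine Finset.prod_congr rfl fun i _ => ?_
  rw [withDensity_apply _ (hs i), ofReal_integral_eq_lintegral_ofReal (hfs i) (ae_of_all _ (hf0 i))]

/-- The density of the image of `g • ρ` under an equivalence scaling `ρ`, relative to `g • ρ`. -/
lemma map_withDensity_eq_withDensity_div {α : Type*} [MeasurableSpace α] {ρ : Measure α}
    (A : α ≃ᵐ α) {c : ℝ} (hc : 0 ≤ c) (hA : ρ.map A = ENNReal.ofReal c • ρ)
    {g : α → ℝ} (hg : Measurable g) (hg0 : ∀ x, 0 < g x) :
    (ρ.withDensity fun x => ENNReal.ofReal (g x)).map A =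
      (ρ.withDensity fun x => ENNReal.ofReal (g x)).withDensity
        fun y => ENNReal.ofReal (c * g (A.symm y) / g y) := by
  have hgA : Measurable fun y => g (A.symm y) := hg.comp A.symm.measurable
  ext s hs
  rw [A.map_apply, withDensity_apply _ (A.measurable hs), withDensity_apply _ hs,
    restrict_withDensity hs, lintegral_withDensity_eq_lintegral_mul _ (by fun_prop) (by fun_prop)]
  have h1 (y : α) : ENNReal.ofReal (g y) * ENNReal.ofReal (c * g (A.symm y) / g y) =
      ENNReal.ofReal c * ENNReal.ofReal (g (A.symm y)) := by
    rw [← ENNReal.ofReal_mul (hg0 y).le, ← ENNReal.ofReal_mul hc, mul_div_cancel₀ _ (hg0 y).ne']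
  simp only [Pi.mul_apply, h1]
  rw [lintegral_const_mul _ (by fun_prop), ← smul_eq_mul, ← lintegral_smul_measure,
    ← Measure.restrict_smul, ← hA, setLIntegral_map hs (by fun_prop) A.measurable]
  simp

end MeasureTheory

namespace ProbabilityTheory

lemma integrable_and_integral_sq_affine_stdGaussian {ι : Type*} [Fintype ι] (c : ℝ) (a : ι → ℝ) :
    Integrable (fun z : ι → ℝ => (c + a ⬝ᵥ z) ^ 2) (Measure.pi fun _ => gaussianReal 0 1) ∧
      ∫ z : ι → ℝ, (c + a ⬝ᵥ z) ^ 2 ∂(Measure.pi fun _ => gaussianReal 0 1) =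
        c ^ 2 + a ⬝ᵥ a := by
  set γ : Measure (ι → ℝ) := Measure.pi fun _ => gaussianReal 0 1
  have hid : MemLp (fun x : ℝ => x) 2 (gaussianReal 0 1) := memLp_id_gaussianReal 2
  have hcoord (i : ι) : MemLp (fun z : ι → ℝ => a i * z i) 2 γ :=
    (hid.comp_measurePreserving (measurePreserving_eval (fun _ => gaussianReal 0 1) i)).const_mul _
  have hsum : MemLp (fun z : ι → ℝ => a ⬝ᵥ z) 2 γ := memLp_finsetSum _ fun i _ => hcoord i
  have hL : MemLp (fun z : ι → ℝ => c + a ⬝ᵥ z) 2 γ := (memLp_const c).add hsum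
  refine ⟨hL.integrable_sq, ?_⟩
  have hmean0 : ∫ z, a ⬝ᵥ z ∂γ = 0 := by
    simp only [dotProduct]
    rw [integral_finsetSum _ fun i _ => (hcoord i).integrable one_le_two]
    simp [γ, integral_const_mul, integral_eval]
  have hmean : ∫ z, c + a ⬝ᵥ z ∂γ = c := by
    rw [integral_add (integrable_const _) (hsum.integrable one_le_two), hmean0]
    simp
  have hvar : Var[fun z => c + a ⬝ᵥ z; γ] = a ⬝ᵥ a := by
    rw [variance_const_add hsum.aestronglyMeasurable]
    have : (fun z : ι → ℝ => a ⬝ᵥ z) = ∑ i, fun z : ι → ℝ => a i * z i := by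
      ext z; simp [dotProduct]
    rw [this, variance_sum_pi (X := fun i x => a i * x) fun i => hid.const_mul _]
    refine Finset.sum_congr rfl fun i _ => ?_
    rw [variance_const_mul, variance_fun_id_gaussianReal]
    simp [pow_two]
  have := variance_eq_sub hL
  rw [hvar, hmean] at this
  simp only [Pi.pow_apply] at this
  linarith

lemma integrable_and_integral_dotProduct_self_affine_stdGaussian {ι : Type*} [Fintype ι]
    (b : ι → ℝ) (B : Matrix ι ι ℝ) :
    Integrable (fun z : ι → ℝ => (b + B *ᵥ z) ⬝ᵥ (b + B *ᵥ z))
        (Measure.pi fun _ => gaussianReal 0 1) ∧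
      ∫ z : ι → ℝ, (b + B *ᵥ z) ⬝ᵥ (b + B *ᵥ z) ∂(Measure.pi fun _ => gaussianReal 0 1) =
        b ⬝ᵥ b + (B * Bᵀ).trace := by
  have h (i : ι) := integrable_and_integral_sq_affine_stdGaussian (b i) (B i)
  have heq : (fun z : ι → ℝ => (b + B *ᵥ z) ⬝ᵥ (b + B *ᵥ z)) =
      fun z => ∑ i, (b i + B i ⬝ᵥ z) ^ 2 := by
    ext z; simp [dotProduct, mulVec, pow_two]
  rw [heq]
  refine ⟨integrable_finsetSum _ fun i _ => (h i).1, ?_⟩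
  rw [integral_finsetSum _ fun i _ => (h i).1]
  simp only [(h _).2, Finset.sum_add_distrib]
  simp [dotProduct, Matrix.trace, Matrix.mul_apply, pow_two]

lemma log_prod_gaussianPDFReal {ι : Type*} [Fintype ι] (x : ι → ℝ) :
    Real.log (∏ i, gaussianPDFReal 0 1 (x i)) =
      Fintype.card ι * Real.log (√(2 * Real.pi))⁻¹ - x ⬝ᵥ x / 2 := by
  rw [Real.log_prod fun i _ => (gaussianPDFReal_pos 0 1 (x i) one_ne_zero).ne']
  have h (t : ℝ) : Real.log (gaussianPDFReal 0 1 t) = Real.log (√(2 * Real.pi))⁻¹ - t * t / 2 := by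
    rw [gaussianPDFReal, Real.log_mul (by positivity) (by positivity), Real.log_exp]
    simp
    ring
  simp [h, dotProduct, Finset.sum_div]

/-- Relative entropy of an affine image of the standard Gaussian measure with respect to the
standard Gaussian measure. -/
lemma integral_log_rnDeriv_map_affine_stdGaussian {ι : Type*} [Fintype ι] [DecidableEq ι]
    (b : ι → ℝ) (B : Matrix ι ι ℝ) (hB : IsUnit B.det) :
    let γ : Measure (ι → ℝ) := Measure.pi fun _ => gaussianReal 0 1
    let A := affineMeasurableEquiv b B hB
    γ.map A ≪ γ ∧
    ∫ y, Real.log ((γ.map A).rnDeriv γ y).toReal ∂(γ.map A) =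
      Real.log |B.det⁻¹| + (b ⬝ᵥ b + (B * Bᵀ).trace - Fintype.card ι) / 2 := by
  intro γ A
  set g : (ι → ℝ) → ℝ := fun x => ∏ i, gaussianPDFReal 0 1 (x i)
  have hg : Measurable g := by fun_prop
  have hg0 (x : ι → ℝ) : 0 < g x :=
    Finset.prod_pos fun i _ => gaussianPDFReal_pos 0 1 (x i) one_ne_zero
  have hγ : γ = volume.withDensity fun x => ENNReal.ofReal (g x) := by
    have := Measure.pi_withDensity_ofReal (fun _ : ι => (volume : Measure ℝ))
      (f := fun _ => gaussianPDFReal 0 1) (fun _ => integrable_gaussianPDFReal 0 1)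
      (fun _ => gaussianPDFReal_nonneg 0 1)
    rw [volume_pi, ← this]
    simp only [γ, gaussianReal_of_var_ne_zero 0 one_ne_zero]
    rfl
  have hdet : 0 < |B.det⁻¹| := abs_pos.mpr (inv_ne_zero hB.ne_zero)
  have hmap : γ.map A =
      γ.withDensity fun y => ENNReal.ofReal (|B.det⁻¹| * g (A.symm y) / g y) := by
    rw [hγ]
    exact map_withDensity_eq_withDensity_div A hdet.le (map_affineMeasurableEquiv_volume b B hB)
      hg hg0
  have hac : γ.map A ≪ γ := hmap ▸ withDensity_absolutelyContinuous _ _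
  refine ⟨hac, ?_⟩
  have hgA : Measurable fun y => g (A.symm y) := hg.comp A.symm.measurable
  have hrn : ∀ᵐ y ∂(γ.map A), Real.log ((γ.map A).rnDeriv γ y).toReal =
      Real.log (|B.det⁻¹| * g (A.symm y) / g y) := by
    have h := Measure.rnDeriv_withDensity γ
      (f := fun y => ENNReal.ofReal (|B.det⁻¹| * g (A.symm y) / g y)) (by fun_prop)
    rw [← hmap] at h
    filter_upwards [hac.ae_le h] with y hy
    rw [hy, ENNReal.toReal_ofReal]
    have := hg0 (A.symm y)
    have := hg0 y
    positivity
  rw [integral_congr_ae hrn, integral_map_equiv]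
  obtain ⟨hi1, he1⟩ := integrable_and_integral_dotProduct_self_affine_stdGaussian b B
  obtain ⟨hi2, he2⟩ := integrable_and_integral_dotProduct_self_affine_stdGaussian
    (0 : ι → ℝ) (1 : Matrix ι ι ℝ)
  simp only [one_mulVec, zero_add, transpose_one, mul_one, trace_one, dotProduct_zero] at hi2 he2
  have hlog (z : ι → ℝ) : Real.log (|B.det⁻¹| * g (A.symm (A z)) / g (A z)) =
      Real.log |B.det⁻¹| + ((b + B *ᵥ z) ⬝ᵥ (b + B *ᵥ z) - z ⬝ᵥ z) / 2 := by
    rw [A.symm_apply_apply, Real.log_div (mul_pos hdet (hg0 _)).ne' (hg0 _).ne',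
      Real.log_mul hdet.ne' (hg0 _).ne', log_prod_gaussianPDFReal, log_prod_gaussianPDFReal]
    simp only [A, affineMeasurableEquiv_apply]
    ring
  have hdiff : Integrable (fun z => ((b + B *ᵥ z) ⬝ᵥ (b + B *ᵥ z) - z ⬝ᵥ z) / 2) γ :=
    (hi1.sub hi2).div_const 2
  simp only [hlog]
  rw [integral_add (integrable_const _) hdiff, integral_div,
    integral_sub hi1 hi2, he1, he2]
  simp

end ProbabilityTheory

/-- The Kullback–Leibler divergence is invariant under a measurable embedding. -/
lemma integral_log_rnDeriv_map_of_measurableEmbedding {α β : Type*} [MeasurableSpace α]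
    [MeasurableSpace β] {f : α → β} (hf : MeasurableEmbedding f) {μ ν : Measure α}
    [SigmaFinite μ] [SigmaFinite ν] (hμν : μ ≪ ν) :
    ∫ y, Real.log ((μ.map f).rnDeriv (ν.map f) y).toReal ∂(μ.map f) =
      ∫ x, Real.log (μ.rnDeriv ν x).toReal ∂μ := by
  rw [hf.integral_map]
  refine integral_congr_ae ?_
  filter_upwards [hμν.ae_le (hf.rnDeriv_map μ ν)] with x hx
  rw [hx]

/-- Gaussian Kullback–Leibler upper bound, in precision parameterization:
for means `m₁, m₂ ∈ ℝ^p` and symmetric positive definite precision matrices `Ω₁, Ω₂`,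
`2 KL(N(m₁, Ω₁⁻¹) ‖ N(m₂, Ω₂⁻¹)) ≤ (m₁ - m₂)ᵀ Ω₂ (m₁ - m₂) + tr(Ω₂ Ω₁⁻¹ - I)
  + tr(Ω₁ Ω₂⁻¹ - I)`. -/
theorem stmt9 {p : ℕ} (m₁ m₂ : EuclideanSpace ℝ (Fin p))
    (Ω₁ Ω₂ : Matrix (Fin p) (Fin p) ℝ) (h₁ : Ω₁.PosDef) (h₂ : Ω₂.PosDef) :
    2 * klDivergence (gaussianEuclidean m₁ h₁.inv.posSemidef)
        (gaussianEuclidean m₂ h₂.inv.posSemidef)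
      ≤ dotProduct (fun i => (m₁ - m₂) i) (Ω₂.mulVec fun i => (m₁ - m₂) i)
        + (Ω₂ * Ω₁⁻¹ - 1).trace + (Ω₁ * Ω₂⁻¹ - 1).trace := by
  set S₁ := h₁.inv.posSemidef.sqrt
  set S₂ := h₂.inv.posSemidef.sqrt
  have hd₁ : IsUnit Ω₁.det := h₁.det_pos.ne'.isUnit
  have hd₂ : IsUnit Ω₂.det := h₂.det_pos.ne'.isUnit
  have hq₁ : S₁ * S₁ = Ω₁⁻¹ := h₁.inv.posSemidef.sqrt_mul_self
  have hq₂ : S₂ * S₂ = Ω₂⁻¹ := h₂.inv.posSemidef.sqrt_mul_self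
  have ht₁ : S₁ᵀ = S₁ := h₁.inv.posSemidef.transpose_sqrt
  have ht₂ : S₂ᵀ = S₂ := h₂.inv.posSemidef.transpose_sqrt
  have hu₁ : IsUnit S₁.det := isUnit_of_mul_isUnit_left
    (by rw [← det_mul, hq₁]; exact h₁.inv.det_pos.ne'.isUnit)
  have hu₂ : IsUnit S₂.det := isUnit_of_mul_isUnit_left
    (by rw [← det_mul, hq₂]; exact h₂.inv.det_pos.ne'.isUnit)
  have hi₁ : S₁⁻¹ * S₁⁻¹ = Ω₁ := by rw [← Matrix.mul_inv_rev, hq₁, nonsing_inv_nonsing_inv _ hd₁]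
  have hi₂ : S₂⁻¹ * S₂⁻¹ = Ω₂ := by rw [← Matrix.mul_inv_rev, hq₂, nonsing_inv_nonsing_inv _ hd₂]
  set B := S₂⁻¹ * S₁ with hB_def
  set d : Fin p → ℝ := fun i => (m₁ - m₂) i with hd_def
  set b := S₂⁻¹ *ᵥ d with hb_def
  have hB : IsUnit B.det := by
    rw [hB_def, det_mul]
    exact (isUnit_nonsing_inv_det _ hu₂).mul hu₁
  obtain ⟨hac, hint⟩ := integral_log_rnDeriv_map_affine_stdGaussian b B hB
  set γ : Measure (Fin p → ℝ) := Measure.pi fun _ => gaussianReal 0 1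
  set A := affineMeasurableEquiv b B hB
  set T : (Fin p → ℝ) ≃ᵐ EuclideanSpace ℝ (Fin p) :=
    (affineMeasurableEquiv m₂.ofLp S₂ hu₂).trans (MeasurableEquiv.toLp 2 (Fin p → ℝ))
  have hν : gaussianEuclidean m₂ h₂.inv.posSemidef = γ.map T := rfl
  have hμ : gaussianEuclidean m₁ h₁.inv.posSemidef = (γ.map A).map T := by
    rw [Measure.map_map T.measurable A.measurable]
    refine congrArg (γ.map ·) (funext fun x => ?_)
    ext i
    have h1 : S₂ *ᵥ (b + B *ᵥ x) = d + S₁ *ᵥ x := by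
      rw [mulVec_add, hb_def, mulVec_mulVec, mulVec_mulVec, hB_def, ← Matrix.mul_assoc,
        mul_nonsing_inv _ hu₂, one_mulVec, Matrix.one_mul]
    change m₁ i + (S₁ *ᵥ x) i = m₂ i + (S₂ *ᵥ (b + B *ᵥ x)) i
    rw [h1]
    simp [hd_def]
    ring
  have : IsProbabilityMeasure (γ.map A) :=
    Measure.isProbabilityMeasure_map A.measurable.aemeasurable
  have hkl : klDivergence (gaussianEuclidean m₁ h₁.inv.posSemidef)
      (gaussianEuclidean m₂ h₂.inv.posSemidef) =
      Real.log |B.det⁻¹| + (b ⬝ᵥ b + (B * Bᵀ).trace - Fintype.card (Fin p)) / 2 := by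
    rw [hμ, hν, klDivergence,
      integral_log_rnDeriv_map_of_measurableEmbedding T.measurableEmbedding hac, hint]
  have hti₁ : S₁⁻¹ᵀ = S₁⁻¹ := by rw [transpose_nonsing_inv, ht₁]
  have hti₂ : S₂⁻¹ᵀ = S₂⁻¹ := by rw [transpose_nonsing_inv, ht₂]
  have hbb : b ⬝ᵥ b = d ⬝ᵥ Ω₂ *ᵥ d := by
    rw [← hi₂, ← mulVec_mulVec, dotProduct_mulVec d, ← mulVec_transpose, hti₂]
  have htr : (B * Bᵀ).trace = (Ω₂ * Ω₁⁻¹).trace := by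
    rw [hB_def, transpose_mul, hti₂, ht₁, ← hi₂, ← hq₁, trace_mul_comm]
    simp only [Matrix.mul_assoc]
    rw [trace_mul_comm]
    simp only [Matrix.mul_assoc]
  have hBinv : B⁻¹ = S₁⁻¹ * S₂ := by
    rw [hB_def, Matrix.mul_inv_rev, nonsing_inv_nonsing_inv _ hu₂]
  have htr' : (B⁻¹ * B⁻¹ᵀ).trace = (Ω₁ * Ω₂⁻¹).trace := by
    rw [hBinv, transpose_mul, hti₁, ht₂, ← hi₁, ← hq₂, trace_mul_comm]
    simp only [Matrix.mul_assoc]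
    rw [trace_mul_comm]
    simp only [Matrix.mul_assoc]
  have hpsd : (B⁻¹ * B⁻¹ᵀ).PosSemidef := by
    simpa [conjTranspose_eq_transpose_of_trivial] using posSemidef_self_mul_conjTranspose B⁻¹
  have hdetB : (B⁻¹ * B⁻¹ᵀ).det = |B.det⁻¹| ^ 2 := by
    rw [det_mul, det_transpose, det_nonsing_inv, Ring.inverse_eq_inv', sq_abs, pow_two]
  have hlog := hpsd.log_det_le (by
    rw [hdetB]
    exact pow_ne_zero _ (abs_ne_zero.mpr (inv_ne_zero hB.ne_zero)))
  rw [hdetB, Real.log_pow, htr'] at hlog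
  push_cast at hlog
  rw [hkl, hbb, htr, trace_sub, trace_sub, trace_one]
  linarith
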